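/- Let (G_n) be a sequence of bipartite graphs on finite sets (X_n, Y_n), each X_n carrying a probability measure μ_n with deg(x) ≥ 1 for all x ∈ X_n. Let F : ℂ → ℝ≥0 be continuous, let f_n : X_n → ℂ and g_n : Y_n → ℂ, and let E : ℕ → ℝ>0 with E(n) → 0 as n → ∞. Assume that for every rectangle R = R(w; R₁, R₂) := {z ∈ ℂ : |Re(z−w)| ≤ R₁, |Im(z−w)| ≤ R₂} one has μ_n({x ∈ X_n : f_n(x) ∈ R}) → ∫_R F(z) dz as n → ∞, and that whenever (x,y) ∈ G_n one has |f_n(x) − g_n(y)| ≤ E(n). Then for every rectangle R ⊆ ℂ one has G_n(μ_n)({y ∈ Y_n : g_n(y) ∈ R}) → ∫_R F(z) dz as n → ∞. -/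

import Mathlib

open Finset Filter

open MeasureTheory in
lemma aux_null (w : ℂ) (a b : ℝ) :
    ∀ᵐ z : ℂ, |(z - w).re| ≠ a ∧ |(z - w).im| ≠ b := by
  have hfin : ∀ c d : ℝ, ({x : ℝ | |x - c| = d}).Finite := by
    intro c d
    refine Set.Finite.subset (Set.toFinite ({c + d, c - d} : Set ℝ)) ?_
    intro x hx
    simp only [Set.mem_setOf_eq] at hx
    simp only [Set.mem_insert_iff, Set.mem_singleton_iff]
    rcases abs_choice (x - c) with h | h <;> rw [h] at hx
    · left; linarith
    · right; linarith
  have hre : Measure.QuasiMeasurePreserving Complex.re volume volume :=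
    Measure.quasiMeasurePreserving_fst.comp
      Complex.volume_preserving_equiv_real_prod.quasiMeasurePreserving
  have him : Measure.QuasiMeasurePreserving Complex.im volume volume :=
    Measure.quasiMeasurePreserving_snd.comp
      Complex.volume_preserving_equiv_real_prod.quasiMeasurePreserving
  have h1 : ∀ᵐ x : ℝ, ¬ |x - w.re| = a := by
    rw [ae_iff]; simpa using (hfin w.re a).measure_zero volume
  have h2 : ∀ᵐ x : ℝ, ¬ |x - w.im| = b := by
    rw [ae_iff]; simpa using (hfin w.im b).measure_zero volume
  filter_upwards [hre.ae h1, him.ae h2] with z hz1 hz2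
  exact ⟨by simpa using hz1, by simpa using hz2⟩

open MeasureTheory in
lemma aux_cont (F : ℂ → ℝ) (hFc : Continuous F) (w : ℂ) (R₁ R₂ : ℝ) :
    Tendsto (fun ε : ℝ => ∫ z in {z : ℂ | |(z - w).re| ≤ R₁ + ε ∧ |(z - w).im| ≤ R₂ + ε}, F z)
      (nhds 0) (nhds (∫ z in {z : ℂ | |(z - w).re| ≤ R₁ ∧ |(z - w).im| ≤ R₂}, F z)) := by
  have hcl : ∀ a b : ℝ, IsClosed {z : ℂ | |(z - w).re| ≤ a ∧ |(z - w).im| ≤ b} := by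
    intro a b
    rw [Set.setOf_and]
    refine IsClosed.inter (isClosed_le ?_ continuous_const) (isClosed_le ?_ continuous_const)
    · exact (Complex.continuous_re.comp (continuous_id.sub continuous_const)).abs
    · exact (Complex.continuous_im.comp (continuous_id.sub continuous_const)).abs
  have hcpt : ∀ a b : ℝ, IsCompact {z : ℂ | |(z - w).re| ≤ a ∧ |(z - w).im| ≤ b} := by
    intro a b
    refine (isCompact_closedBall w (a + b)).of_isClosed_subset (hcl a b) ?_
    rintro z ⟨h1, h2⟩
    rw [Metric.mem_closedBall, dist_eq_norm]
    exact (Complex.norm_le_abs_re_add_abs_im _).trans (add_le_add h1 h2)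
  simp_rw [← integral_indicator (hcl _ _).measurableSet]
  refine tendsto_integral_filter_of_dominated_convergence
    ({z : ℂ | |(z - w).re| ≤ R₁ + 1 ∧ |(z - w).im| ≤ R₂ + 1}.indicator fun z => ‖F z‖) ?_ ?_ ?_ ?_
  · exact Eventually.of_forall fun ε =>
      (hFc.measurable.indicator (hcl _ _).measurableSet).aestronglyMeasurable
  · filter_upwards [Iio_mem_nhds (zero_lt_one' ℝ)] with ε hε
    refine Eventually.of_forall fun z => ?_
    rw [norm_indicator_eq_indicator_norm]
    refine Set.indicator_le_indicator_of_subset ?_ (fun _ => norm_nonneg _) z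
    rintro z ⟨h1, h2⟩
    have : ε < 1 := hε
    exact ⟨by linarith, by linarith⟩
  · rw [integrable_indicator_iff (hcl _ _).measurableSet]
    exact hFc.norm.continuousOn.integrableOn_compact (hcpt _ _)
  · filter_upwards [aux_null w R₁ R₂] with z hz
    have hid : ∀ a : ℝ, Tendsto (fun ε : ℝ => a + ε) (nhds 0) (nhds a) := by
      intro a
      have : Continuous fun ε : ℝ => a + ε := by fun_prop
      simpa using this.tendsto 0
    have key : ∀ a b : ℝ, b ≠ a → ∀ᶠ ε : ℝ in nhds 0, (b ≤ a + ε ↔ b ≤ a) := by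
      intro a b hab
      rcases lt_or_gt_of_ne hab with h | h
      · filter_upwards [(hid a).eventually (lt_mem_nhds h)] with ε hε
        exact ⟨fun _ => h.le, fun _ => hε.le⟩
      · filter_upwards [(hid a).eventually (gt_mem_nhds h)] with ε hε
        exact ⟨fun h' => absurd h' (not_le.2 hε), fun h' => absurd h' (not_le.2 h)⟩
    refine tendsto_nhds_of_eventually_eq ?_
    filter_upwards [key R₁ _ hz.1, key R₂ _ hz.2] with ε h1 h2
    simp only [Set.indicator, Set.mem_setOf_eq, h1, h2]

lemma aux_swap {X Y : Type} [Fintype X] [Fintype Y] [DecidableEq X] [DecidableEq Y]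
    (G : Finset (X × Y)) (μ : X → ℝ) (Q : Y → Prop) [DecidablePred Q] :
    (∑ y ∈ univ.filter Q, ∑ x ∈ univ.filter (fun x => (x, y) ∈ G),
      μ x / ((univ.filter fun y' => (x, y') ∈ G).card : ℝ)) =
    ∑ x, ((univ.filter fun y => (x, y) ∈ G ∧ Q y).card : ℝ) *
      (μ x / ((univ.filter fun y' => (x, y') ∈ G).card : ℝ)) := by
  rw [Finset.sum_comm' (t' := univ)
    (s' := fun x => univ.filter fun y => (x, y) ∈ G ∧ Q y)]
  · simp
  · intro y x; simp [and_comm]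

lemma aux_upper {X Y : Type} [Fintype X] [Fintype Y] [DecidableEq X] [DecidableEq Y]
    (G : Finset (X × Y)) (μ : X → ℝ) (hμ0 : ∀ x, 0 ≤ μ x)
    (hdeg : ∀ x, 1 ≤ (univ.filter fun y => (x, y) ∈ G).card)
    (P : X → Prop) [DecidablePred P] (Q : Y → Prop) [DecidablePred Q]
    (h : ∀ x y, (x, y) ∈ G → Q y → P x) :
    (∑ y ∈ univ.filter Q, ∑ x ∈ univ.filter (fun x => (x, y) ∈ G),
      μ x / ((univ.filter fun y' => (x, y') ∈ G).card : ℝ)) ≤ ∑ x ∈ univ.filter P, μ x := by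
  rw [aux_swap, Finset.sum_filter]
  refine Finset.sum_le_sum fun x _ => ?_
  have hd : (0 : ℝ) < ((univ.filter fun y => (x, y) ∈ G).card : ℝ) := by
    exact_mod_cast hdeg x
  split_ifs with hP
  · rw [mul_div_assoc', div_le_iff₀ hd, mul_comm]
    refine mul_le_mul_of_nonneg_left ?_ (hμ0 x)
    exact_mod_cast Finset.card_le_card fun y hy => by
      simp only [Finset.mem_filter] at hy ⊢; exact ⟨hy.1, hy.2.1⟩
  · rw [Finset.filter_false_of_mem fun y _ hy => hP (h x y hy.1 hy.2)]
    simp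

lemma aux_lower {X Y : Type} [Fintype X] [Fintype Y] [DecidableEq X] [DecidableEq Y]
    (G : Finset (X × Y)) (μ : X → ℝ) (hμ0 : ∀ x, 0 ≤ μ x)
    (hdeg : ∀ x, 1 ≤ (univ.filter fun y => (x, y) ∈ G).card)
    (P : X → Prop) [DecidablePred P] (Q : Y → Prop) [DecidablePred Q]
    (h : ∀ x y, (x, y) ∈ G → P x → Q y) :
    ∑ x ∈ univ.filter P, μ x ≤ (∑ y ∈ univ.filter Q, ∑ x ∈ univ.filter (fun x => (x, y) ∈ G),
      μ x / ((univ.filter fun y' => (x, y') ∈ G).card : ℝ)) := by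
  rw [aux_swap, Finset.sum_filter]
  refine Finset.sum_le_sum fun x _ => ?_
  have hd : (0 : ℝ) < ((univ.filter fun y => (x, y) ∈ G).card : ℝ) := by
    exact_mod_cast hdeg x
  split_ifs with hP
  · rw [mul_div_assoc', le_div_iff₀ hd, mul_comm]
    refine mul_le_mul_of_nonneg_right ?_ (hμ0 x)
    exact_mod_cast Finset.card_le_card fun y hy => by
      simp only [Finset.mem_filter] at hy ⊢; exact ⟨hy.1, hy.2, h x y hy.2 hP⟩
  · exact mul_nonneg (Nat.cast_nonneg _) (div_nonneg (hμ0 x) hd.le)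

lemma aux_geom {a b w : ℂ} {ε R₁ R₂ : ℝ} (hab : ‖a - b‖ ≤ ε)
    (h : |(a - w).re| ≤ R₁ ∧ |(a - w).im| ≤ R₂) :
    |(b - w).re| ≤ R₁ + ε ∧ |(b - w).im| ≤ R₂ + ε := by
  have h1 := (Complex.abs_re_le_norm (a - b)).trans hab
  have h2 := (Complex.abs_im_le_norm (a - b)).trans hab
  simp only [Complex.sub_re, Complex.sub_im, abs_le] at *
  refine ⟨⟨?_, ?_⟩, ⟨?_, ?_⟩⟩ <;> linarith [h.1.1, h.1.2, h.2.1, h.2.2, h1.1, h1.2, h2.1, h2.2]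

/-- Complex version of the lifting lemma: if the complex values `f_n` on
`X_n` equidistribute with continuous density `F : ℂ → ℝ≥0` over all rectangles
`R(w; R₁, R₂) = {z : |Re(z−w)| ≤ R₁, |Im(z−w)| ≤ R₂}`, and `|f_n(x) − g_n(y)| ≤ E(n) → 0`
along every edge of `G_n`, then for every rectangle the `G_n`-transformed measure of
`{y : g_n(y) ∈ R}` tends to `∫_R F(z) dz`. -/
theorem stmt_5 (X Y : ℕ → Type) [∀ n, Fintype (X n)] [∀ n, Fintype (Y n)]
    [∀ n, DecidableEq (X n)] [∀ n, DecidableEq (Y n)]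
    (G : ∀ n, Finset (X n × Y n))
    (μ : ∀ n, X n → ℝ) (hμ0 : ∀ n x, 0 ≤ μ n x) (hμ1 : ∀ n, ∑ x, μ n x = 1)
    (hdeg : ∀ n (x : X n), 1 ≤ (univ.filter fun y => (x, y) ∈ G n).card)
    (F : ℂ → ℝ) (hF0 : ∀ z, 0 ≤ F z) (hFc : Continuous F)
    (f : ∀ n, X n → ℂ) (g : ∀ n, Y n → ℂ)
    (E : ℕ → ℝ) (hE : ∀ n, 0 < E n) (hE0 : Tendsto E atTop (nhds 0))
    (hf : ∀ (w : ℂ) (R₁ R₂ : ℝ), 0 < R₁ → 0 < R₂ →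
      Tendsto (fun n =>
          ∑ x ∈ univ.filter (fun x => |(f n x - w).re| ≤ R₁ ∧ |(f n x - w).im| ≤ R₂), μ n x)
        atTop
        (nhds (∫ z in {z : ℂ | |(z - w).re| ≤ R₁ ∧ |(z - w).im| ≤ R₂}, F z)))
    (hfg : ∀ n (x : X n) (y : Y n), (x, y) ∈ G n → ‖f n x - g n y‖ ≤ E n) :
    ∀ (w : ℂ) (R₁ R₂ : ℝ), 0 < R₁ → 0 < R₂ →
      Tendsto (fun n =>
          ∑ y ∈ univ.filter (fun y => |(g n y - w).re| ≤ R₁ ∧ |(g n y - w).im| ≤ R₂),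
            ∑ x ∈ univ.filter (fun x => (x, y) ∈ G n),
              μ n x / ((univ.filter fun y' => (x, y') ∈ G n).card : ℝ))
        atTop
        (nhds (∫ z in {z : ℂ | |(z - w).re| ≤ R₁ ∧ |(z - w).im| ≤ R₂}, F z)) := by
  intro w R₁ R₂ hR₁ hR₂
  have hc := aux_cont F hFc w R₁ R₂
  rw [tendsto_order]
  constructor
  · intro a ha
    have h1 := hc.eventually (lt_mem_nhds ha)
    obtain ⟨δ, hδ, hball⟩ := Metric.eventually_nhds_iff.1 h1
    obtain ⟨ε, hε0, hε⟩ := exists_between (lt_min hδ (lt_min hR₁ hR₂))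
    simp only [lt_min_iff] at hε
    have h2 := @hball (-ε) (by simpa [abs_of_pos hε0] using hε.1)
    have h3 := (hf w (R₁ + -ε) (R₂ + -ε) (by linarith) (by linarith)).eventually (lt_mem_nhds h2)
    filter_upwards [h3, hE0.eventually (gt_mem_nhds hε0)] with n hn hEn
    refine hn.trans_le (aux_lower (G n) (μ n) (hμ0 n) (hdeg n) _ _ fun x y hxy hP => ?_)
    have := aux_geom ((hfg n x y hxy).trans hEn.le) hP
    simpa using this
  · intro a ha
    have h1 := hc.eventually (gt_mem_nhds ha)
    obtain ⟨δ, hδ, hball⟩ := Metric.eventually_nhds_iff.1 h1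
    obtain ⟨ε, hε0, hε⟩ := exists_between hδ
    have h2 := @hball ε (by simpa [abs_of_pos hε0] using hε)
    have h3 := (hf w (R₁ + ε) (R₂ + ε) (by linarith) (by linarith)).eventually (gt_mem_nhds h2)
    filter_upwards [h3, hE0.eventually (gt_mem_nhds hε0)] with n hn hEn
    refine (aux_upper (G n) (μ n) (hμ0 n) (hdeg n) _ _ fun x y hxy hQ => ?_).trans_lt hn
    have h := (hfg n x y hxy).trans hEn.le
    rw [norm_sub_rev] at h
    exact aux_geom h hQ
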